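/- arXiv:2009.08288 — 3 statements merged into one kernel-verified Lean document; each statement's English description precedes it below -/
import Mathlib

section
/- Let (ξ_n)_{n∈ℕ} be an exchangeable sequence of integrable real-valued random variables on a probability space (Ω,F,P), let E be its exchangeable σ-algebra and T its tail σ-algebra, and set ξ := E[ξ_1 | E]. Then for every n ∈ ℕ we have P-almost surely ξ = E[ξ_n | E] = E[ξ_n | T]. -/
open MeasureTheory Filter Finset

/-- A permutation of `ℕ` is *finite* if it moves only finitely many elements. -/
def IsFinitePerm (π : Equiv.Perm ℕ) : Prop :=
  {n | π n ≠ n}.Finite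

/-- A sequence of real-valued random variables is *exchangeable* if for every finite
permutation `π` of `ℕ`, the permuted sequence has the same joint distribution. -/
def Exchangeable {Ω : Type*} [MeasurableSpace Ω] (P : Measure Ω) (ξ : ℕ → Ω → ℝ) : Prop :=
  ∀ π : Equiv.Perm ℕ, IsFinitePerm π →
    Measure.map (fun ω => fun n => ξ (π n) ω) P = Measure.map (fun ω => fun n => ξ n ω) P

/-- The σ-algebra of measurable sets of `ℕ → ℝ` that are invariant under every
finite permutation of the coordinates. -/
def symmetricSigma : MeasurableSpace (ℕ → ℝ) where
  MeasurableSet' B := MeasurableSet B ∧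
    ∀ π : Equiv.Perm ℕ, IsFinitePerm π → (fun x => fun n => x (π n)) ⁻¹' B = B
  measurableSet_empty := ⟨MeasurableSet.empty, fun _ _ => Set.preimage_empty⟩
  measurableSet_compl := fun s hs =>
    ⟨hs.1.compl, fun π hπ => by rw [Set.preimage_compl, hs.2 π hπ]⟩
  measurableSet_iUnion := fun f hf =>
    ⟨MeasurableSet.iUnion fun i => (hf i).1, fun π hπ => by
      rw [Set.preimage_iUnion]; exact Set.iUnion_congr fun i => (hf i).2 π hπ⟩

/-- The exchangeable σ-algebra of the sequence `ξ`: events of the form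
`{ω | (n ↦ ξ n ω) ∈ B}` with `B` measurable and invariant under finite permutations. -/
def exchangeableSigma {Ω : Type*} (ξ : ℕ → Ω → ℝ) : MeasurableSpace Ω :=
  MeasurableSpace.comap (fun ω => fun n => ξ n ω) symmetricSigma

/-- The tail σ-algebra of the sequence `ξ`: `⋂ n, σ(ξ n, ξ (n+1), …)`. -/
def tailSigma {Ω : Type*} (ξ : ℕ → Ω → ℝ) : MeasurableSpace Ω :=
  ⨅ n : ℕ, MeasurableSpace.comap (fun ω => fun k => ξ (n + k) ω) inferInstance

open scoped symmDiff ENNReal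

/-- The block-swapping permutation `i ↔ i + N` for `i < N`. -/
def blockSwap (N : ℕ) : Equiv.Perm ℕ :=
  Function.Involutive.toPerm (fun i => if i < N then i + N else if i < 2 * N then i - N else i)
    (by intro i; dsimp only; split_ifs <;> omega)

lemma blockSwap_apply (N i : ℕ) :
    blockSwap N i = if i < N then i + N else if i < 2 * N then i - N else i := rfl

lemma blockSwap_finite (N : ℕ) : IsFinitePerm (blockSwap N) := by
  refine (Set.finite_lt_nat (2 * N)).subset ?_
  intro i hi
  by_contra h
  apply hi
  simp only [Set.mem_ofPred_eq, not_lt] at h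
  rw [blockSwap_apply, if_neg (by omega), if_neg (by omega)]

lemma measurable_seq {Ω : Type*} {mΩ : MeasurableSpace Ω} {ξ : ℕ → Ω → ℝ}
    (hmeas : ∀ n, Measurable (ξ n)) : Measurable (fun ω => fun n => ξ n ω) :=
  measurable_pi_iff.2 hmeas

lemma symmetricSigma_le : symmetricSigma ≤ (MeasurableSpace.pi : MeasurableSpace (ℕ → ℝ)) :=
  fun _ hB => hB.1

lemma exchangeableSigma_le {Ω : Type*} {mΩ : MeasurableSpace Ω} {ξ : ℕ → Ω → ℝ}
    (hmeas : ∀ n, Measurable (ξ n)) : exchangeableSigma ξ ≤ mΩ := by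
  rintro _ ⟨B, hB, rfl⟩
  exact measurable_seq hmeas hB.1

lemma comap_shift_antitone {Ω : Type*} (ξ : ℕ → Ω → ℝ) {n k : ℕ} (h : n ≤ k) :
    MeasurableSpace.comap (fun ω => fun j => ξ (k + j) ω) (inferInstance : MeasurableSpace (ℕ → ℝ)) ≤
    MeasurableSpace.comap (fun ω => fun j => ξ (n + j) ω) (inferInstance : MeasurableSpace (ℕ → ℝ)) := by
  rintro _ ⟨B, hB, rfl⟩
  refine ⟨(fun x : ℕ → ℝ => fun j => x (k - n + j)) ⁻¹' B, ?_, ?_⟩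
  · exact (measurable_pi_iff.2 fun j => measurable_pi_apply _) hB
  · ext ω
    simp only [Set.mem_preimage]
    have : (fun j => ξ (n + (k - n + j)) ω) = fun j => ξ (k + j) ω := by
      funext j
      congr 1
      omega
    rw [this]

/-- A limsup of events, the `k`-th of which depends on `ξ k, ξ (k+1), …`, is a tail event. -/
lemma measurableSet_tail_limsup {Ω : Type*} (ξ : ℕ → Ω → ℝ) (D : ℕ → Set Ω)
    (hD : ∀ k, MeasurableSet[MeasurableSpace.comap (fun ω => fun j => ξ (k + j) ω) inferInstance]
      (D k)) : MeasurableSet[tailSigma ξ] (limsup D atTop) := by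
  rw [tailSigma, MeasurableSpace.measurableSet_iInf]
  intro n
  rw [← limsup_nat_add D n]
  refine @MeasurableSet.measurableSet_limsup _ (_) _ fun k => ?_
  exact comap_shift_antitone ξ (Nat.le_add_left n k) _ (hD _)

lemma tailSigma_le {Ω : Type*} (ξ : ℕ → Ω → ℝ) : tailSigma ξ ≤ exchangeableSigma ξ := by
  intro A hA
  rw [tailSigma, MeasurableSpace.measurableSet_iInf] at hA
  choose B hB hBA using hA
  let C : ℕ → Set (ℕ → ℝ) := fun k => (fun x : ℕ → ℝ => fun j => x (k + j)) ⁻¹' B k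
  have hC : ∀ k, MeasurableSet (C k) := fun k =>
    (measurable_pi_iff.2 fun j => measurable_pi_apply _) (hB k)
  refine ⟨limsup C atTop, ⟨MeasurableSet.measurableSet_limsup hC, ?_⟩, ?_⟩
  · intro π hπ
    ext x
    simp only [Set.mem_preimage, mem_limsup_iff_frequently_mem]
    refine frequently_congr ?_
    obtain ⟨M, hM⟩ := hπ.bddAbove
    filter_upwards [eventually_gt_atTop M] with k hk
    have : (fun j => x (π (k + j))) = fun j => x (k + j) := by
      funext j
      congr 1
      by_contra hne
      have := hM (show k + j ∈ {n | π n ≠ n} from hne)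
      omega
    change (fun j => x (π (k + j))) ∈ B k ↔ (fun j => x (k + j)) ∈ B k
    rw [this]
  · ext ω
    simp only [Set.mem_preimage, mem_limsup_iff_frequently_mem]
    have : ∀ k, (fun n => ξ n ω) ∈ C k ↔ ω ∈ A := fun k => by
      conv_rhs => rw [← hBA k]
      rfl
    simp [this]

lemma exists_approx {Ω : Type*} {mΩ : MeasurableSpace Ω} (P : Measure Ω)
    [IsProbabilityMeasure P] (ξ : ℕ → Ω → ℝ) (hmeas : ∀ n, Measurable (ξ n))
    (hexch : Exchangeable P ξ) (A : Set Ω) (hA : MeasurableSet[exchangeableSigma ξ] A)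
    (k : ℕ) {ε : ℝ≥0∞} (hε : 0 < ε) :
    ∃ D, MeasurableSet[MeasurableSpace.comap (fun ω => fun j => ξ (k + j) ω) inferInstance] D ∧
      P (D ∆ A) < ε := by
  obtain ⟨B, hB, rfl⟩ := hA
  have hX := measurable_seq hmeas
  have := Measure.isProbabilityMeasure_map (μ := P) hX.aemeasurable
  obtain ⟨t, ht, htB⟩ := exists_measure_symmDiff_lt_of_generateFrom_isSetRing
    (μ := Measure.map (fun ω => fun n => ξ n ω) P)
    (isSetRing_measurableCylinders (α := fun _ : ℕ => ℝ))
    ⟨{Set.univ}, Set.countable_singleton _, by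
      simpa using univ_mem_measurableCylinders (fun _ : ℕ => ℝ), by simp⟩
    generateFrom_measurableCylinders.symm hB.1 hε
  obtain ⟨s, S, hS, rfl⟩ := (mem_measurableCylinders _).1 ht
  obtain ⟨M, hM⟩ := s.bddAbove
  let N := max k (M + 1)
  let π := blockSwap N
  have hπ : IsFinitePerm π := blockSwap_finite N
  have hs : ∀ i ∈ s, i < N := fun i hi => by
    have := hM hi
    omega
  refine ⟨(fun ω => fun n => ξ (π n) ω) ⁻¹' cylinder s S, ?_, ?_⟩
  · refine ⟨(fun (x : ℕ → ℝ) (i : s) => x (N + i - k)) ⁻¹' S, ?_, ?_⟩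
    · exact (measurable_pi_iff.2 fun j => measurable_pi_apply _) hS
    · ext ω
      simp only [Set.mem_preimage, mem_cylinder]
      have : (fun i : s => ξ (k + (N + i - k)) ω) = s.restrict fun n => ξ (π n) ω := by
        funext i
        have := hs i i.2
        simp only [Finset.restrict, π, blockSwap_apply, if_pos this]
        congr 1
        omega
      rw [this]
  · have h1 : (fun ω => fun n => ξ n ω) ⁻¹' B = (fun ω => fun n => ξ (π n) ω) ⁻¹' B := by
      conv_lhs => rw [← hB.2 π hπ]
      rfl
    have hXπ := measurable_seq (ξ := fun n => ξ (π n)) fun n => hmeas _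
    rw [h1, ← Set.preimage_symmDiff, ← Measure.map_apply hXπ, hexch π hπ]
    · exact htB
    · exact (hS.cylinder s).symmDiff hB.1

lemma exists_tail_ae_eq {Ω : Type*} {mΩ : MeasurableSpace Ω} (P : Measure Ω)
    [IsProbabilityMeasure P] (ξ : ℕ → Ω → ℝ) (hmeas : ∀ n, Measurable (ξ n))
    (hexch : Exchangeable P ξ) (A : Set Ω) (hA : MeasurableSet[exchangeableSigma ξ] A) :
    ∃ A', MeasurableSet[tailSigma ξ] A' ∧ A' =ᵐ[P] A := by
  obtain ⟨ε, hε, hsum⟩ := ENNReal.exists_pos_sum_of_countable' one_ne_zero ℕ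
  choose D hD hDA using fun k => exists_approx P ξ hmeas hexch A hA k (hε k)
  refine ⟨limsup D atTop, measurableSet_tail_limsup ξ D hD, ?_⟩
  have hfin : ∑' k, P (D k ∆ A) ≠ ∞ :=
    ((ENNReal.tsum_le_tsum fun k => (hDA k).le).trans_lt (hsum.trans ENNReal.one_lt_top)).ne
  refine eventuallyEq_set.2 ?_
  filter_upwards [ae_eventually_notMem hfin] with ω hω
  rw [mem_limsup_iff_frequently_mem]
  have : (∃ᶠ k in atTop, ω ∈ D k) ↔ ∃ᶠ k : ℕ in atTop, ω ∈ A := by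
    refine frequently_congr ?_
    filter_upwards [hω] with k hk
    rw [Set.mem_symmDiff] at hk
    tauto
  rw [this]
  simp

lemma setIntegral_exch {Ω : Type*} {mΩ : MeasurableSpace Ω} (P : Measure Ω)
    (ξ : ℕ → Ω → ℝ) (hmeas : ∀ n, Measurable (ξ n))
    (hexch : Exchangeable P ξ) (n : ℕ) (A : Set Ω) (hA : MeasurableSet[exchangeableSigma ξ] A) :
    ∫ ω in A, ξ n ω ∂P = ∫ ω in A, ξ 0 ω ∂P := by
  obtain ⟨B, hB, rfl⟩ := hA
  have hX := measurable_seq hmeas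
  let π := Equiv.swap 0 n
  have hπ : IsFinitePerm π := by
    refine (Set.toFinite {0, n}).subset fun i hi => ?_
    by_contra h
    simp only [Set.mem_insert_iff, Set.mem_singleton_iff, not_or] at h
    exact hi (Equiv.swap_apply_of_ne_of_ne h.1 h.2)
  have hXπ := measurable_seq (ξ := fun n => ξ (π n)) fun n => hmeas _
  have h1 : (fun ω => fun n => ξ n ω) ⁻¹' B = (fun ω => fun n => ξ (π n) ω) ⁻¹' B := by
    conv_lhs => rw [← hB.2 π hπ]
    rfl
  have e0 := setIntegral_map (μ := P) hB.1 (f := fun x : ℕ → ℝ => x 0)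
    (measurable_pi_apply 0).aestronglyMeasurable hX.aemeasurable
  have e1 := setIntegral_map (μ := P) hB.1 (f := fun x : ℕ → ℝ => x 0)
    (measurable_pi_apply 0).aestronglyMeasurable hXπ.aemeasurable
  rw [hexch π hπ, e0, ← h1] at e1
  rw [e1]
  simp [π]

theorem condexp_exchangeable_eq {Ω : Type*} {mΩ : MeasurableSpace Ω} (P : Measure Ω)
    [IsProbabilityMeasure P] (ξ : ℕ → Ω → ℝ) (hmeas : ∀ n, Measurable (ξ n))
    (hint : ∀ n, Integrable (ξ n) P) (hexch : Exchangeable P ξ) (n : ℕ) :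
    P[ξ 0 | exchangeableSigma ξ] =ᵐ[P] P[ξ n | exchangeableSigma ξ] ∧
    P[ξ 0 | exchangeableSigma ξ] =ᵐ[P] P[ξ n | tailSigma ξ] := by
  have hE := exchangeableSigma_le hmeas
  have hTE := tailSigma_le ξ
  have hT := hTE.trans hE
  constructor
  · refine ae_eq_condExp_of_forall_setIntegral_eq hE (hint n)
      (fun _ _ _ => integrable_condExp.integrableOn) (fun A hA _ => ?_)
      stronglyMeasurable_condExp.aestronglyMeasurable
    rw [setIntegral_condExp hE (hint 0) hA, setIntegral_exch P ξ hmeas hexch n A hA]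
  · symm
    refine ae_eq_condExp_of_forall_setIntegral_eq hE (hint 0)
      (fun _ _ _ => integrable_condExp.integrableOn) (fun A hA _ => ?_)
      (stronglyMeasurable_condExp.mono hTE).aestronglyMeasurable
    obtain ⟨A', hA', hAA'⟩ := exists_tail_ae_eq P ξ hmeas hexch A hA
    rw [← setIntegral_exch P ξ hmeas hexch n A hA, ← setIntegral_congr_set hAA',
      ← setIntegral_congr_set hAA', setIntegral_condExp hT (hint n) hA']
end

section
/- Let (Ω,F,P) be a probability space, let G ⊆ F be a sub-σ-algebra, and let X be an integrable real-valued random variable such that X and its conditional expectation E[X | G] have the same distribution (i.e. the pushforward measures P ∘ X⁻¹ and P ∘ (E[X | G])⁻¹ coincide). Then X = E[X | G] P-almost surely. -/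
open MeasureTheory

/-- If an integrable random variable `X` has the same distribution as its
conditional expectation `E[X | G]`, then `X = E[X | G]` almost surely. -/
theorem eq_condexp_of_map_eq {Ω : Type*} {G mΩ : MeasurableSpace Ω} (P : Measure Ω)
    [IsProbabilityMeasure P] (hG : G ≤ mΩ)
    (X : Ω → ℝ) (hX : Measurable[mΩ] X) (hXint : Integrable X P)
    (hdist : P.map X = P.map (P[X | G])) :
    X =ᵐ[P] P[X | G] := by
  set Y := P[X | G] with hYdef
  have hYG : Measurable[G] Y := stronglyMeasurable_condExp.measurable
  have hY : Measurable Y := hYG.mono hG le_rfl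
  have hYint : Integrable Y P := integrable_condExp
  have key : ∀ q : ℚ, ∀ᵐ ω ∂P, max (X ω - q) 0 =
      Set.indicator {ω | (q : ℝ) < Y ω} (fun ω => X ω - q) ω := by
    intro q
    have hA : MeasurableSet[G] {ω | (q : ℝ) < Y ω} := hYG measurableSet_Ioi
    have hA' : MeasurableSet {ω | (q : ℝ) < Y ω} := hG _ hA
    have hXq : Integrable (fun ω => X ω - q) P := hXint.sub (integrable_const _)
    have hm : Measurable (fun x : ℝ => max (x - q) 0) := by fun_prop
    have h1 : ∫ ω, max (X ω - q) 0 ∂P = ∫ ω, max (Y ω - q) 0 ∂P := by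
      rw [← integral_map (f := fun x : ℝ => max (x - q) 0) hX.aemeasurable
          hm.aestronglyMeasurable, hdist,
        integral_map hY.aemeasurable hm.aestronglyMeasurable]
    have h2 : ∫ ω, max (Y ω - q) 0 ∂P =
        ∫ ω, Set.indicator {ω | (q : ℝ) < Y ω} (fun ω => X ω - q) ω ∂P := by
      have : (fun ω => max (Y ω - q) 0) =
          Set.indicator {ω | (q : ℝ) < Y ω} (fun ω => Y ω - q) := by
        ext ω
        by_cases h : (q : ℝ) < Y ω
        · simp [Set.indicator, h, h.le]
        · simp [Set.indicator, h, not_lt.1 h]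
      rw [this, integral_indicator hA', integral_indicator hA',
        integral_sub hYint.integrableOn (integrable_const _),
        integral_sub hXint.integrableOn (integrable_const _),
        setIntegral_condExp hG hXint hA]
    have hle : (Set.indicator {ω | (q : ℝ) < Y ω} (fun ω => X ω - q)) ≤ᵐ[P]
        (fun ω => max (X ω - q) 0) := by
      refine Filter.Eventually.of_forall fun ω => ?_
      by_cases h : (q : ℝ) < Y ω <;> simp [Set.indicator, h]
    have := (integral_eq_iff_of_ae_le (hXq.indicator hA') hXq.pos_part hle).1 (h1.trans h2).symm
    exact this.symm
  filter_upwards [ae_all_iff.2 key] with ω h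
  apply le_antisymm
  · by_contra! hc
    obtain ⟨q, hq1, hq2⟩ := exists_rat_btwn hc
    have := h q
    rw [Set.indicator_of_notMem (by simpa using hq1.le)] at this
    linarith [le_max_left (X ω - q) 0]
  · by_contra! hc
    obtain ⟨q, hq1, hq2⟩ := exists_rat_btwn hc
    have := h q
    rw [Set.indicator_of_mem (by simpa using hq2)] at this
    linarith [le_max_right (X ω - q) 0]
end

section
/- Let (Ω,F,P) be a probability space and G ⊆ F a sub-σ-algebra. Let (X_n)_{n∈ℕ} and (Y_n)_{n∈ℕ} be sequences of real-valued random variables and X an integrable real-valued random variable. Assume that for every n ∈ ℕ the random variables X_n and Y_n have the same distribution, that X_n → X P-almost surely, and that Y_n → E[X | G] P-almost surely. Then X = E[X | G] P-almost surely. -/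
open MeasureTheory Filter

/-- If `X n` and `Y n` have the same distribution for every `n`, `X n → X` a.s. and
`Y n → E[X | G]` a.s., then `X = E[X | G]` almost surely. -/
theorem eq_condexp_of_tendsto {Ω : Type*} {G mΩ : MeasurableSpace Ω} (P : Measure Ω)
    [IsProbabilityMeasure P] (hG : G ≤ mΩ)
    (X : ℕ → Ω → ℝ) (Y : ℕ → Ω → ℝ) (hXmeas : ∀ n, Measurable[mΩ] (X n))
    (hYmeas : ∀ n, Measurable[mΩ] (Y n)) (Z : Ω → ℝ) (hZmeas : Measurable[mΩ] Z)
    (hZint : Integrable Z P)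
    (hdist : ∀ n, P.map (X n) = P.map (Y n))
    (hXtendsto : ∀ᵐ ω ∂P, Tendsto (fun n => X n ω) atTop (nhds (Z ω)))
    (hYtendsto : ∀ᵐ ω ∂P, Tendsto (fun n => Y n ω) atTop (nhds ((P[Z | G]) ω))) :
    Z =ᵐ[P] P[Z | G] := by
  have hWG : StronglyMeasurable[G] (P[Z | G]) := stronglyMeasurable_condExp
  have hWint : Integrable (P[Z | G]) P := integrable_condExp
  have hsetint : ∀ s, MeasurableSet[G] s → ∫ ω in s, (P[Z | G]) ω ∂P = ∫ ω in s, Z ω ∂P :=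
    fun s hs => setIntegral_condExp hG hZint hs
  generalize P[Z | G] = W at *
  have hWm : Measurable[mΩ] W := (hWG.mono hG).measurable
  -- equality of the laws of the limits
  have hlaw : P.map Z = P.map W := by
    have : IsProbabilityMeasure (P.map Z) := Measure.isProbabilityMeasure_map hZmeas.aemeasurable
    have : IsProbabilityMeasure (P.map W) := Measure.isProbabilityMeasure_map hWm.aemeasurable
    refine ext_of_forall_integral_eq_of_IsFiniteMeasure fun f => ?_
    have key : ∀ (U : ℕ → Ω → ℝ) (V : Ω → ℝ), (∀ n, Measurable[mΩ] (U n)) →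
        (∀ᵐ ω ∂P, Tendsto (fun n => U n ω) atTop (nhds (V ω))) →
        Tendsto (fun n => ∫ ω, f (U n ω) ∂P) atTop (nhds (∫ ω, f (V ω) ∂P)) := by
      intro U V hU hUV
      refine tendsto_integral_of_dominated_convergence (fun _ => ‖f‖) (fun n => ?_)
        (integrable_const _) (fun n => ae_of_all _ fun ω => f.norm_coe_le_norm _) ?_
      · exact (f.continuous.measurable.comp (hU n)).aestronglyMeasurable
      · filter_upwards [hUV] with ω h
        exact (f.continuous.tendsto _).comp h
    rw [integral_map hZmeas.aemeasurable f.continuous.aestronglyMeasurable,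
      integral_map hWm.aemeasurable f.continuous.aestronglyMeasurable]
    refine tendsto_nhds_unique (key X Z hXmeas hXtendsto) ?_
    have h2 := key Y W hYmeas hYtendsto
    refine h2.congr fun n => ?_
    rw [← integral_map (hYmeas n).aemeasurable f.continuous.aestronglyMeasurable, ← hdist n,
      integral_map (hXmeas n).aemeasurable f.continuous.aestronglyMeasurable]
  have hc : ∀ c : ℚ, ∀ᵐ ω ∂P, {ω | (c : ℝ) < W ω}.indicator (fun ω => Z ω - c) ω
      = max (Z ω - c) 0 := by
    intro c
    have hA : MeasurableSet[G] {ω | (c : ℝ) < W ω} :=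
      hWG.measurable measurableSet_Ioi
    have hi : Integrable (fun ω => Z ω - (c : ℝ)) P := hZint.sub (integrable_const _)
    have hint1 : Integrable ({ω | (c : ℝ) < W ω}.indicator (fun ω => Z ω - c)) P :=
      hi.indicator (hG _ hA)
    have hint2 : Integrable (fun ω => max (Z ω - (c : ℝ)) 0) P := hi.pos_part
    have hle : {ω | (c : ℝ) < W ω}.indicator (fun ω => Z ω - c)
        ≤ᵐ[P] fun ω => max (Z ω - (c : ℝ)) 0 := by
      refine ae_of_all _ fun ω => ?_
      by_cases h : (c : ℝ) < W ω <;> simp [Set.indicator, h]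
    refine (integral_eq_iff_of_ae_le hint1 hint2 hle).1 ?_
    have hm : Measurable fun x : ℝ => max (x - (c : ℝ)) 0 := by fun_prop
    have e1 : ∫ ω, max (Z ω - (c : ℝ)) 0 ∂P = ∫ ω, max (W ω - (c : ℝ)) 0 ∂P := by
      rw [← integral_map (f := fun x : ℝ => max (x - (c : ℝ)) 0) hZmeas.aemeasurable
        hm.aestronglyMeasurable, hlaw,
        integral_map hWm.aemeasurable hm.aestronglyMeasurable]
    have e2 : (fun ω => max (W ω - (c : ℝ)) 0)
        = {ω | (c : ℝ) < W ω}.indicator (fun ω => W ω - c) := by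
      ext ω
      by_cases h : (c : ℝ) < W ω
      · simp [Set.indicator, h, h.le]
      · simp [Set.indicator, h, not_lt.1 h]
    rw [e1, e2, integral_indicator (hG _ hA), integral_indicator (hG _ hA),
      integral_sub hZint.integrableOn (integrable_const _),
      integral_sub hWint.integrableOn (integrable_const _), hsetint _ hA]
  filter_upwards [ae_all_iff.2 hc] with ω h
  by_contra hne
  rcases lt_or_gt_of_ne hne with hlt | hlt
  · obtain ⟨c, h1, h2⟩ := exists_rat_btwn hlt
    have := h c
    simp only [Set.indicator, Set.mem_ofPred_eq, h2, if_true] at this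
    have h3 := le_max_right (Z ω - (c : ℝ)) 0
    linarith
  · obtain ⟨c, h1, h2⟩ := exists_rat_btwn hlt
    have := h c
    simp only [Set.indicator, Set.mem_ofPred_eq, not_lt.2 h1.le, if_false] at this
    have h3 := le_max_left (Z ω - (c : ℝ)) 0
    linarith
end
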